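/- Let κ be a rational number with 4 < κ < 8. Then every real number ρ with κ/4 − 1 < ρ < κ/4, ρ ≠ 1, and sin(8π/κ)·ρ = sin(8πρ/κ) is transcendental over ℚ. -/

import Mathlib

open Real
open scoped NumberField

theorem Differentiable.exists_eq_prod_sub_mul {f : ℂ → ℂ} (hf : Differentiable ℂ f)
    (s : Finset ℂ) (hs : ∀ w ∈ s, f w = 0) :
    ∃ g : ℂ → ℂ, Differentiable ℂ g ∧ ∀ z, f z = (∏ w ∈ s, (z - w)) * g z := by
  induction s using Finset.induction_on generalizing f with
  | empty => exact ⟨f, hf, by simp⟩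
  | insert a s ha ih =>
    have hfa : f a = 0 := hs a (Finset.mem_insert_self a s)
    have hd : Differentiable ℂ (dslope f a) :=
      differentiableOn_univ.1
        ((Complex.differentiableOn_dslope Filter.univ_mem).2 hf.differentiableOn)
    have hmul (z : ℂ) : f z = (z - a) * dslope f a z := by
      simpa [hfa] using (sub_smul_dslope f a z).symm
    obtain ⟨g, hg, hfg⟩ := ih hd fun w hw ↦ by
      have hwa : w - a ≠ 0 := sub_ne_zero.2 (ne_of_mem_of_not_mem hw ha)
      have h := hmul w
      rw [hs w (Finset.mem_insert_of_mem hw)] at h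
      exact (mul_eq_zero.1 h.symm).resolve_left hwa
    exact ⟨g, hg, fun z ↦ by rw [hmul, hfg, Finset.prod_insert ha, mul_assoc]⟩

/-- A Schwarz lemma for several zeros. -/
theorem Differentiable.norm_le_div_two_pow_card {f : ℂ → ℂ} (hf : Differentiable ℂ f)
    {s : Finset ℂ} {r M : ℝ} (hr : 0 < r) (hs : ∀ w ∈ s, f w = 0) (hsr : ∀ w ∈ s, ‖w‖ ≤ r)
    (hM : ∀ z, ‖z‖ = 5 * r → ‖f z‖ ≤ M) {z₀ : ℂ} (hz₀ : ‖z₀‖ ≤ r) :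
    ‖f z₀‖ ≤ M / 2 ^ s.card := by
  obtain ⟨g, hg, hfg⟩ := hf.exists_eq_prod_sub_mul s hs
  have hgs (z : ℂ) (hz : ‖z‖ = 5 * r) : ‖g z‖ ≤ M / (4 * r) ^ s.card := by
    have hprod : (4 * r) ^ s.card ≤ ‖∏ w ∈ s, (z - w)‖ := by
      rw [norm_prod, ← Finset.prod_const]
      refine Finset.prod_le_prod (fun _ _ ↦ by positivity) fun w hw ↦ ?_
      linarith [norm_sub_norm_le z w, hsr w hw]
    rw [le_div_iff₀ (by positivity), mul_comm]
    calc (4 * r) ^ s.card * ‖g z‖ ≤ ‖∏ w ∈ s, (z - w)‖ * ‖g z‖ := by gcongr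
      _ = ‖f z‖ := by rw [hfg, norm_mul]
      _ ≤ M := hM z hz
  have hg₀ : ‖g z₀‖ ≤ M / (4 * r) ^ s.card := by
    refine Complex.norm_le_of_forall_mem_frontier_norm_le (U := Metric.ball 0 (5 * r))
      Metric.isBounded_ball hg.diffContOnCl (fun z hz ↦ hgs z ?_)
      (subset_closure (by simp; linarith))
    rw [frontier_ball _ (by positivity)] at hz
    simpa using hz
  have hprod : ‖∏ w ∈ s, (z₀ - w)‖ ≤ (2 * r) ^ s.card := by
    rw [norm_prod, ← Finset.prod_const]
    refine Finset.prod_le_prod (fun _ _ ↦ by positivity) fun w hw ↦ ?_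
    linarith [norm_sub_le z₀ w, hsr w hw]
  calc ‖f z₀‖ ≤ (2 * r) ^ s.card * (M / (4 * r) ^ s.card) := by
        rw [hfg, norm_mul]; gcongr
    _ = M / 2 ^ s.card := by
        rw [show 4 * r = 2 * (2 * r) by ring, mul_pow 2 (2 * r)]
        field_simp

open NumberField in
theorem NumberField.house.exists_const_siegel (K : Type*) [Field K] [NumberField K] :
    ∃ c : ℝ, ∀ (p : ℕ) (α β : Type) [Fintype α] [Fintype β] (a : Matrix α β (𝓞 K)) (A : ℝ),
      a ≠ 0 → 0 < p → Fintype.card α = p → Fintype.card β = 2 * p →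
      (∀ k l, house (a k l : K) ≤ A) →
      ∃ ξ : β → 𝓞 K, ξ ≠ 0 ∧ a.mulVec ξ = 0 ∧ ∀ l, house (ξ l : K) ≤ c * (c * (2 * p) * A) := by
  classical
  obtain ⟨c, hc⟩ : ∃ c : ℝ, ∀ (p q : ℕ) (α β : Type) [Fintype α] [Fintype β]
      (a : Matrix α β (𝓞 K)) (A : ℝ), a ≠ 0 → 0 < p → p < q → Fintype.card α = p →
      Fintype.card β = q → (∀ k l, house (a k l : K) ≤ A) →
      ∃ ξ : β → 𝓞 K, ξ ≠ 0 ∧ a.mulVec ξ = 0 ∧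
        ∀ l, house (ξ l : K) ≤ c * (c * q * A) ^ ((p : ℝ) / (q - p)) :=
    ⟨_, fun p q α β _ _ a A ha hp hpq hα hβ hA ↦
      exists_ne_zero_int_vec_house_le K a ha hp hpq hβ hA hα⟩
  refine ⟨c, fun p α β _ _ a A ha hp hα hβ hA ↦ ?_⟩
  have h := hc p (2 * p) α β a A ha hp (by lia) hα hβ hA
  have he : (p : ℝ) / ((2 * p : ℕ) - p) = 1 := by
    push_cast
    rw [two_mul, add_sub_cancel_right, div_self (by positivity)]
  rw [he] at h
  simpa only [Real.rpow_one, Nat.cast_mul, Nat.cast_ofNat] using h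

theorem NumberField.one_le_norm_mul_house_pow {K : Type*} [Field K] [NumberField K]
    (σ : K →+* ℂ) {x : 𝓞 K} (hx : x ≠ 0) :
    1 ≤ ‖σ x‖ * house (x : K) ^ (Module.finrank ℚ K - 1) := by
  refine le_trans ?_ (norm_norm_le_norm_mul_house_pow (x : K) σ)
  rw [← Algebra.coe_norm_int]
  have h : Algebra.norm ℤ x ≠ 0 := Algebra.norm_ne_zero_iff.2 hx
  rw [← Rat.norm_cast_real, Rat.cast_intCast, Real.norm_eq_abs]
  exact_mod_cast Int.one_le_abs h

theorem exists_pow_mul_lt_two_pow {Q : ℝ} (hQ : 1 ≤ Q) (k : ℕ) :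
    ∃ N : ℕ, 1 ≤ N ∧ ∀ S : ℕ, N ^ 2 ≤ S → (Q * S) ^ (k * N) < 2 ^ S := by
  have ho : (fun x : ℝ ↦ (k : ℝ) * (Real.log Q + Real.log x)) =o[Filter.atTop]
      fun x : ℝ ↦ x ^ (1 / 2 : ℝ) := by
    refine ((Asymptotics.isLittleO_const_left.2 (Or.inr ?_)).add
      (isLittleO_log_rpow_atTop (by norm_num))).const_mul_left _
    exact Filter.tendsto_abs_atTop_atTop.comp (tendsto_rpow_atTop (by norm_num))
  have hl : (0 : ℝ) < Real.log 2 / 2 := by positivity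
  obtain ⟨x₀, hx₀⟩ := Filter.eventually_atTop.1 (ho.def hl)
  refine ⟨⌈x₀⌉₊ + 1, by lia, fun S hS ↦ ?_⟩
  set N := ⌈x₀⌉₊ + 1
  have hNS : N ≤ S := by nlinarith [Nat.zero_le ⌈x₀⌉₊]
  have hS1 : (1 : ℝ) ≤ S := by exact_mod_cast (by lia : 1 ≤ S)
  have hxS : x₀ ≤ S := (Nat.le_ceil x₀).trans (by exact_mod_cast (by lia : ⌈x₀⌉₊ ≤ S))
  have h := hx₀ S hxS
  rw [← Real.sqrt_eq_rpow, Real.norm_of_nonneg (Real.sqrt_nonneg _),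
    ← Real.log_mul (by positivity) (by positivity)] at h
  have h' := (Real.le_norm_self _).trans h
  have hN : (N : ℝ) ≤ √S := Real.le_sqrt_of_sq_le (by exact_mod_cast hS)
  rw [← Real.log_lt_log_iff (by positivity) (by positivity), Real.log_pow, Real.log_pow]
  have hlog : 0 ≤ Real.log (Q * S) := Real.log_nonneg (by nlinarith)
  push_cast
  calc (k : ℝ) * N * Real.log (Q * S) = N * (k * Real.log (Q * S)) := by ring
    _ ≤ √S * (Real.log 2 / 2 * √S) := by gcongr
    _ = S * (Real.log 2 / 2) := by nlinarith [Real.mul_self_sqrt (Nat.cast_nonneg (α := ℝ) S)]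
    _ < S * Real.log 2 := by gcongr; linarith

theorem NumberField.abs_le_two_of_intCast_mul_eq {K : Type*} [Field K] [NumberField K]
    {e : K} {n : ℕ} (hn : n ≠ 0) (he : e ^ n = 1) {a : ℤ} {x : 𝓞 K} (hx : x ≠ 0)
    (h : (a : K) * x = e - e⁻¹) : |a| ≤ 2 := by
  obtain ⟨τ, hτ⟩ := exists_conjugate_one_le_norm hx
  have he₁ : ‖τ e‖ = 1 := Complex.norm_eq_one_of_pow_eq_one (by rw [← map_pow, he, map_one]) hn
  have h' : ‖(a : ℂ)‖ * ‖τ x‖ ≤ 2 := by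
    rw [← norm_mul, ← map_intCast τ, ← map_mul, h, map_sub, map_inv₀]
    refine (norm_sub_le _ _).trans_eq ?_
    rw [norm_inv, he₁]; norm_num
  rw [Complex.norm_intCast] at h'
  have : |(a : ℝ)| ≤ 2 := (le_mul_of_one_le_right (abs_nonneg _) hτ).trans h'
  exact_mod_cast this

theorem Real.abs_le_two_of_mul_sin_eq_mul_sin {r s : ℚ} {a b : ℤ} (hab : IsCoprime a b)
    (hr : sin (r * π) ≠ 0) (h : b * sin (r * π) = a * sin (s * π)) : |a| ≤ 2 := by
  rcases eq_or_ne a 0 with rfl | ha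
  · simp
  obtain ⟨u, v, huv⟩ := hab
  have ha' : (a : ℂ) ≠ 0 := by exact_mod_cast ha
  set e : ℂ := Complex.exp (r * π * Complex.I) with he
  have hen : e ^ (2 * r.den) = 1 := Complex.exp_rat_mul_pi_mul_I_pow_two_mul_den r
  have hsin : e - e⁻¹ = 2 * Complex.sin (r * π) * Complex.I := by
    rw [he, ← Complex.exp_neg, Complex.sin, ← neg_mul]
    linear_combination
      (Complex.exp (r * π * Complex.I) - Complex.exp (-(r * π) * Complex.I)) * Complex.I_sq
  have hc : (b : ℂ) * Complex.sin (r * π) = a * Complex.sin (s * π) := by exact_mod_cast h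
  have huv' : (u : ℂ) * a + v * b = 1 := by exact_mod_cast huv
  have hx : IsIntegral ℤ ((e - e⁻¹) / a) := by
    have heq : (e - e⁻¹) / a =
        (u * (2 * Complex.sin (r * π)) + v * (2 * Complex.sin (s * π))) * Complex.I := by
      rw [hsin, div_eq_iff ha']
      linear_combination (-2 * Complex.sin (r * π) * Complex.I) * huv' + 2 * v * Complex.I * hc
    rw [heq]
    exact (((isIntegral_algebraMap (x := u)).mul (Complex.isIntegral_two_mul_sin_rat_mul_pi r)).add
      ((isIntegral_algebraMap (x := v)).mul (Complex.isIntegral_two_mul_sin_rat_mul_pi s))).mul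
        Complex.isIntegral_int_I
  have : FiniteDimensional ℚ (IntermediateField.adjoin ℚ {e}) :=
    IntermediateField.adjoin.finiteDimensional
      (IsIntegral.tower_top (R := ℤ) (Complex.isIntegral_exp_rat_mul_pi_mul_I r))
  have : NumberField (IntermediateField.adjoin ℚ {e}) := ⟨⟩
  set E : IntermediateField.adjoin ℚ {e} := IntermediateField.AdjoinSimple.gen ℚ e
  have hE : algebraMap _ ℂ E = e := IntermediateField.AdjoinSimple.algebraMap_gen ℚ e
  have hinj := (algebraMap (IntermediateField.adjoin ℚ {e}) ℂ).injective
  have hX : algebraMap _ ℂ ((E - E⁻¹) / a) = (e - e⁻¹) / a := by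
    rw [map_div₀, map_sub, map_inv₀, hE, map_intCast]
  have hint : IsIntegral ℤ ((E - E⁻¹) / a) := (isIntegral_algebraMap_iff hinj).1 (by rwa [hX])
  obtain ⟨x, hxE⟩ : ∃ x : 𝓞 (IntermediateField.adjoin ℚ {e}),
      (x : IntermediateField.adjoin ℚ {e}) = (E - E⁻¹) / a :=
    ⟨⟨_, hint⟩, rfl⟩
  refine NumberField.abs_le_two_of_intCast_mul_eq (e := E) (n := 2 * r.den) (by simp)
    (hinj (by rw [map_pow, hE, hen, map_one])) (x := x) ?_ ?_
  · rintro rfl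
    have hr' : Complex.sin (r * π) ≠ 0 := by exact_mod_cast hr
    rw [← hxE, hsin] at hX
    have hX := hX.symm
    simp [ha', hr'] at hX
  · rw [hxE]
    exact mul_div_cancel₀ _ (by exact_mod_cast ha)

theorem Real.eq_of_mul_sin_eq_sin {r s ρ : ℚ} (hs : sin (s * π) ≠ 0) (hρ : 0 < ρ)
    (h : ρ * sin (s * π) = sin (r * π)) : ρ = 1 / 2 ∨ ρ = 1 ∨ ρ = 2 := by
  have hcop : IsCoprime ρ.num ρ.den := Rat.isCoprime_num_den ρ
  have hρ' : (ρ : ℝ) ≠ 0 := by exact_mod_cast hρ.ne'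
  have hr : sin (r * π) ≠ 0 := h ▸ mul_ne_zero hρ' hs
  have hd : (ρ.den : ℝ) ≠ 0 := by exact_mod_cast ρ.den_ne_zero
  have hrs : ((ρ.den : ℤ) : ℝ) * sin (r * π) = ρ.num * sin (s * π) := by
    rw [← h, Rat.cast_def]; push_cast; field_simp
  have hn := Real.abs_le_two_of_mul_sin_eq_mul_sin hcop hr hrs
  have hd' := Real.abs_le_two_of_mul_sin_eq_mul_sin hcop.symm hs hrs.symm
  have hn₀ : 0 < ρ.num := Rat.num_pos.2 hρ
  have hd₀ := ρ.den_pos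
  have hρe := ρ.num_div_den
  rw [abs_of_pos hn₀] at hn
  have hd'' : ρ.den ≤ 2 := by rw [Nat.abs_cast] at hd'; exact_mod_cast hd'
  generalize ρ.num = p at *
  generalize ρ.den = q at *
  interval_cases p <;> interval_cases q <;> norm_num at hρe <;> simp [← hρe]

theorem Complex.isAlgebraic_exp_mul_I_of_isAlgebraic_sin {z : ℂ} (hz : IsAlgebraic ℚ (sin z)) :
    IsAlgebraic ℚ (exp (z * I)) := by
  have hI : IsAlgebraic ℚ I := (isIntegral_int_I.tower_top (A := ℚ)).isAlgebraic
  have hcos : IsAlgebraic ℚ (cos z) := by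
    refine IsAlgebraic.of_pow two_pos ?_
    rw [cos_sq']
    exact isAlgebraic_one.sub (hz.pow 2)
  rw [exp_mul_I]
  exact hcos.add (hz.mul hI)

namespace GelfondSchneider

/-- The function `z ↦ ∑ cᵢⱼ (m z)ⁱ e^{π i j z}`. -/
noncomputable def expPoly (m : ℕ) {D E : ℕ} (c : Fin D × Fin E → ℂ) (z : ℂ) : ℂ :=
  ∑ l, c l * ((m * z) ^ (l.1 : ℕ) * Complex.exp (π * Complex.I * z) ^ (l.2 : ℕ))

variable {K : Type*} [Field K]

/-- If `B` and `G` are the images of `m β` and `m e^{π i β}`, this is the image of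
`m ^ (E * v)` times the value of `(m z)ⁱ e^{π i j z}` at `z = u + v β`. -/
noncomputable def entry (m : ℕ) (B G : 𝓞 K) (E u v i j : ℕ) : 𝓞 K :=
  (m * u + v * B) ^ i * ((-1) ^ (u * j) * (G ^ j * (m : 𝓞 K) ^ (E - j)) ^ v)

theorem differentiable_expPoly (m : ℕ) {D E : ℕ} (c : Fin D × Fin E → ℂ) :
    Differentiable ℂ (expPoly m c) := by
  unfold expPoly
  fun_prop

theorem norm_expPoly_le {m D E : ℕ} {c : Fin D × Fin E → ℂ} {X R : ℝ} {z : ℂ}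
    (hc : ∀ l, ‖c l‖ ≤ X) (hR : 1 ≤ m * R) (hR₀ : 0 ≤ R) (hz : ‖z‖ ≤ R) :
    ‖expPoly m c z‖ ≤ D * E * (X * ((m * R) ^ D * Real.exp (π * R) ^ E)) := by
  have hterm (l : Fin D × Fin E) :
      ‖c l * ((m * z) ^ (l.1 : ℕ) * Complex.exp (π * Complex.I * z) ^ (l.2 : ℕ))‖ ≤
        X * ((m * R) ^ D * Real.exp (π * R) ^ E) := by
    have hX : 0 ≤ X := (norm_nonneg _).trans (hc l)
    have h₁ : ‖m * z‖ ≤ m * R := by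
      rw [norm_mul, Complex.norm_natCast]; gcongr
    have h₂ : ‖Complex.exp (π * Complex.I * z)‖ ≤ Real.exp (π * R) := by
      refine (Complex.norm_exp_le_exp_norm _).trans (Real.exp_le_exp.2 ?_)
      rw [norm_mul, norm_mul, Complex.norm_I, Complex.norm_real, mul_one,
        Real.norm_of_nonneg pi_pos.le]
      gcongr
    rw [norm_mul, norm_mul, norm_pow, norm_pow]
    gcongr
    · exact hc l
    · exact (pow_le_pow_left₀ (norm_nonneg _) h₁ _).trans (pow_le_pow_right₀ hR l.1.2.le)
    · exact (pow_le_pow_left₀ (norm_nonneg _) h₂ _).trans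
        (pow_le_pow_right₀ (Real.one_le_exp (by positivity)) l.2.2.le)
  refine (norm_sum_le _ _).trans ((Finset.sum_le_sum fun l _ ↦ hterm l).trans_eq ?_)
  simp

theorem exp_pi_mul_I_mul_add (u v : ℕ) (β : ℂ) :
    Complex.exp (π * Complex.I * (u + v * β)) =
      (-1) ^ u * Complex.exp (π * Complex.I * β) ^ v := by
  rw [← Complex.exp_pi_mul_I, ← Complex.exp_nat_mul, ← Complex.exp_nat_mul, ← Complex.exp_add]
  ring_nf

theorem exp_pow_injective {β : ℂ} (hβ : ∀ q : ℚ, β ≠ q) :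
    Function.Injective fun v : ℕ ↦ Complex.exp (π * Complex.I * β) ^ v := by
  intro v w h
  simp only [← Complex.exp_nat_mul] at h
  obtain ⟨n, hn⟩ := Complex.exp_eq_exp_iff_exists_int.1 h
  by_contra hvw
  have hvw' : ((v : ℂ) - w) ≠ 0 := sub_ne_zero.2 (by exact_mod_cast hvw)
  refine hβ (2 * n / (v - w)) ?_
  push_cast
  rw [eq_div_iff hvw']
  have hpi : (π : ℂ) * Complex.I ≠ 0 := by simp [pi_ne_zero]
  apply mul_left_cancel₀ hpi
  linear_combination hn

theorem add_mul_injective {β : ℂ} (hβ : ∀ q : ℚ, β ≠ q) :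
    Function.Injective fun p : ℕ × ℕ ↦ (p.1 : ℂ) + p.2 * β := by
  rintro ⟨u, v⟩ ⟨u', v'⟩ h
  simp only at h
  have hv : v = v' := by
    by_contra hv
    have hv' : ((v : ℂ) - v') ≠ 0 := sub_ne_zero.2 (by exact_mod_cast hv)
    refine hβ ((u' - u) / (v - v')) ?_
    push_cast
    rw [eq_div_iff hv']
    linear_combination h
  subst hv
  have : (u : ℂ) = u' := by linear_combination h
  simpa using this

theorem eq_zero_of_expPoly_eq_zero {m D E : ℕ} (hm : m ≠ 0) {c : Fin D × Fin E → ℂ} {β : ℂ}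
    (hβ : ∀ q : ℚ, β ≠ q) (h : ∀ u v : ℕ, expPoly m c (u + v * β) = 0) : c = 0 := by
  have key (v : ℕ) (i : Fin D) :
      ∑ j : Fin E, c (i, j) * (Complex.exp (π * Complex.I * β) ^ v) ^ (j : ℕ) = 0 := by
    refine congrFun (Matrix.eq_zero_of_forall_index_sum_mul_pow_eq_zero
      (f := fun k : Fin D ↦ (m : ℂ) * ((2 * k : ℕ) + v * β))
      (v := fun i ↦ ∑ j : Fin E, c (i, j) * (Complex.exp (π * Complex.I * β) ^ v) ^ (j : ℕ))
      ?_ fun k ↦ ?_) i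
    · intro k k' hk
      have := mul_left_cancel₀ (by exact_mod_cast hm) hk
      simpa [Fin.ext_iff] using this
    · rw [← h (2 * k : ℕ) v, expPoly, Fintype.sum_prod_type]
      refine Finset.sum_congr rfl fun i _ ↦ ?_
      rw [Finset.sum_mul]
      refine Finset.sum_congr rfl fun j _ ↦ ?_
      rw [exp_pi_mul_I_mul_add, pow_mul, neg_one_sq, one_pow, one_mul]
      ring
  ext ⟨i, j⟩
  exact congrFun (Matrix.eq_zero_of_forall_index_sum_mul_pow_eq_zero
    (f := fun v : Fin E ↦ Complex.exp (π * Complex.I * β) ^ (v : ℕ)) (v := fun j ↦ c (i, j))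
    ((exp_pow_injective hβ).comp Fin.val_injective) fun v ↦ key v i) j

theorem map_entry (σ : K →+* ℂ) {m : ℕ} {B G : 𝓞 K} {β : ℂ} (hB : σ B = m * β)
    (hG : σ G = m * Complex.exp (π * Complex.I * β)) {E j : ℕ} (hj : j ≤ E) (u v i : ℕ) :
    σ (entry m B G E u v i j) = m ^ (E * v) *
      ((m * (u + v * β)) ^ i * Complex.exp (π * Complex.I * (u + v * β)) ^ j) := by
  obtain ⟨k, rfl⟩ := Nat.exists_eq_add_of_le hj
  simp only [entry, map_mul, map_pow, map_add, map_neg, map_one, map_natCast, hB, hG,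
    exp_pi_mul_I_mul_add, Nat.add_sub_cancel_left]
  ring

/-- `∑ ξᵢⱼ entryᵢⱼ`, an algebraic integer which is a multiple of the value of `expPoly`
at `u + v β`. -/
noncomputable def value (m : ℕ) (B G : 𝓞 K) {D E : ℕ} (ξ : Fin D × Fin E → 𝓞 K) (u v : ℕ) : 𝓞 K :=
  ∑ l, ξ l * entry m B G E u v l.1 l.2

theorem map_value (σ : K →+* ℂ) {m : ℕ} {B G : 𝓞 K} {β : ℂ} (hB : σ B = m * β)
    (hG : σ G = m * Complex.exp (π * Complex.I * β)) {D E : ℕ} (ξ : Fin D × Fin E → 𝓞 K)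
    (u v : ℕ) :
    σ (value m B G ξ u v) = m ^ (E * v) * expPoly m (fun l ↦ σ (ξ l)) (u + v * β) := by
  simp only [value, expPoly, map_sum, map_mul, Finset.mul_sum]
  refine Finset.sum_congr rfl fun l _ ↦ ?_
  rw [map_entry σ hB hG l.2.2.le]
  ring

section NumberField

open NumberField

variable [NumberField K]

theorem house_pow_mul_mul_pow_le {x y s : K} {P Q : ℝ} (hx : house x ≤ P) (hs : house s ≤ 1)
    (hy : house y ≤ Q) (i v : ℕ) : house (x ^ i * (s * y ^ v)) ≤ P ^ i * Q ^ v := by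
  have hx' : house (x ^ i) ≤ P ^ i :=
    (house_pow_le x i).trans (pow_le_pow_left₀ (house_nonneg x) hx i)
  have hy' : house (y ^ v) ≤ Q ^ v :=
    (house_pow_le y v).trans (pow_le_pow_left₀ (house_nonneg y) hy v)
  have hsy : house (s * y ^ v) ≤ Q ^ v := by
    refine (house_mul_le _ _).trans ((mul_le_mul hs hy' (house_nonneg _) zero_le_one).trans_eq ?_)
    rw [one_mul]
  exact (house_mul_le _ _).trans
    (mul_le_mul hx' hsy (house_nonneg _) ((house_nonneg _).trans hx'))

theorem house_entry_le {m : ℕ} {B G : 𝓞 K} {C : ℝ} (hm : m ≠ 0)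
    (hC : m + house (B : K) + house (G : K) ≤ C) {D E S u v i j : ℕ} (hu : u ≤ S) (hv : v ≤ S)
    (hS : 1 ≤ S) (hi : i ≤ D) (hj : j ≤ E) :
    house (entry m B G E u v i j : K) ≤ (C * S) ^ D * C ^ (E * S) := by
  have hB := house_nonneg (B : K)
  have hG := house_nonneg (G : K)
  have hm₁ : (1 : ℝ) ≤ m := by exact_mod_cast Nat.one_le_iff_ne_zero.2 hm
  have hS₁ : (1 : ℝ) ≤ S := by exact_mod_cast hS
  have hC₁ : 1 ≤ C := by linarith
  have hnat (n : ℕ) : house (n : K) = n := by simpa using house_intCast (K := K) n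
  have h₁ : house ((m : K) * u + v * B) ≤ C * S := by
    refine (house_add_le _ _).trans ?_
    rw [house_nat_mul, house_nat_mul, hnat]
    calc (m : ℝ) * u + v * house (B : K) ≤ m * S + S * house (B : K) := by gcongr
      _ = (m + house (B : K)) * S := by ring
      _ ≤ C * S := by gcongr; linarith
  have h₂ : house ((-1 : K) ^ (u * j)) ≤ 1 := by
    rcases neg_one_pow_eq_or K (u * j) with h | h <;> rw [h]
    · simpa using (house_intCast (K := K) 1).le
    · simpa using (house_intCast (K := K) (-1)).le
  have h₃ : house ((G : K) ^ j * (m : K) ^ (E - j)) ≤ C ^ E := by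
    have h := house_pow_mul_mul_pow_le (x := (G : K)) (s := 1) (y := (m : K)) (P := C) (Q := C)
      (by linarith) (by simpa using (house_intCast (K := K) 1).le)
      (by rw [hnat]; linarith) j (E - j)
    rwa [one_mul, ← pow_add, Nat.add_sub_cancel' hj] at h
  have hcoe : (entry m B G E u v i j : K) = ((m : K) * u + v * B) ^ i *
      ((-1) ^ (u * j) * ((G : K) ^ j * (m : K) ^ (E - j)) ^ v) := by
    simp only [entry, map_mul, map_pow, map_add, map_neg, map_one, map_natCast]
  rw [hcoe]
  refine (house_pow_mul_mul_pow_le h₁ h₂ h₃ i v).trans ?_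
  rw [← pow_mul]
  have hCS : 1 ≤ C * S := one_le_mul_of_one_le_of_one_le hC₁ hS₁
  gcongr

theorem house_value_le {m : ℕ} {B G : 𝓞 K} {C : ℝ} (hm : m ≠ 0)
    (hC : m + house (B : K) + house (G : K) ≤ C) {D E S u v : ℕ} (hu : u ≤ S) (hv : v ≤ S)
    (hS : 1 ≤ S) {ξ : Fin D × Fin E → 𝓞 K} {X : ℝ} (hξ : ∀ l, house (ξ l : K) ≤ X) :
    house (value m B G ξ u v : K) ≤ D * E * (X * ((C * S) ^ D * C ^ (E * S))) := by
  have hcoe : (value m B G ξ u v : K) = ∑ l, (ξ l : K) * (entry m B G E u v l.1 l.2 : K) := by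
    simp only [value, map_sum, map_mul]
  rw [hcoe]
  refine (house_sum_le_sum_house _ _).trans ((Finset.sum_le_sum fun l _ ↦ ?_).trans_eq
    (b := ∑ _ : Fin D × Fin E, X * ((C * S) ^ D * C ^ (E * S))) ?_)
  · exact (house_mul_le _ _).trans (mul_le_mul (hξ l)
      (house_entry_le hm hC hu hv hS l.1.2.le l.2.2.le) (house_nonneg _)
      ((house_nonneg _).trans (hξ l)))
  · simp

theorem expPoly_eq_zero_of_forall_lt (σ : K →+* ℂ) {m : ℕ} {B G : 𝓞 K} {β : ℂ} (hm : m ≠ 0)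
    (hB : σ B = m * β) (hG : σ G = m * Complex.exp (π * Complex.I * β)) (hβ : ∀ q : ℚ, β ≠ q)
    {Q : ℝ} (hQ₂ : 2 ≤ Q) (hQC : m + house (B : K) + house (G : K) ≤ Q)
    (hQm : m * (5 * (1 + ‖β‖)) ≤ Q) (hQe : Real.exp (π * (5 * (1 + ‖β‖))) ≤ Q)
    {N S : ℕ} (hN : 1 ≤ N) (hNS : N ^ 2 ≤ S)
    (hlt : (Q * S) ^ (13 * Module.finrank ℚ K * N) < 2 ^ S)
    {ξ : Fin (2 * N ^ 3) × Fin N → 𝓞 K} (hξ : ∀ l, house (ξ l : K) ≤ (Q * S) ^ (7 * (N * S)))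
    (h : ∀ u < S, ∀ v < S, expPoly m (fun l ↦ σ (ξ l)) (u + v * β) = 0)
    {u v : ℕ} (hu : u ≤ S) (hv : v ≤ S) :
    expPoly m (fun l ↦ σ (ξ l)) (u + v * β) = 0 := by
  have hS : 1 ≤ S := (Nat.one_le_pow 2 N hN).trans hNS
  have hS' : (1 : ℝ) ≤ S := by exact_mod_cast hS
  have hm' : (1 : ℝ) ≤ m := by exact_mod_cast Nat.one_le_iff_ne_zero.2 hm
  have hL : 1 ≤ 1 + ‖β‖ := by linarith [norm_nonneg β]
  set L := 1 + ‖β‖ with hLdef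
  set Y := Q * S with hY
  have hQY : Q ≤ Y := le_mul_of_one_le_right (by linarith) hS'
  have hY₁ : 1 ≤ Y := by linarith
  have hSY : S ≤ Y := le_mul_of_one_le_left (by linarith) (by linarith)
  have hd : 2 * N ^ 3 ≤ 2 * (N * S) := by nlinarith
  have hcount : ((2 * N ^ 3 : ℕ) : ℝ) * N ≤ Y ^ (2 * (N * S)) := by
    have hN4 : N ^ 2 * N ^ 2 ≤ S * S := Nat.mul_le_mul hNS hNS
    have hN4' : (N : ℝ) ^ 2 * N ^ 2 ≤ S * S := by exact_mod_cast hN4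
    calc ((2 * N ^ 3 : ℕ) : ℝ) * N = 2 * (N ^ 2 * N ^ 2) := by push_cast; ring
      _ ≤ 2 * (S * S) := by gcongr
      _ ≤ Y ^ 2 := by rw [hY]; nlinarith [mul_pos (by linarith : (0 : ℝ) < S) (by linarith : (0 : ℝ) < S)]
      _ ≤ Y ^ (2 * (N * S)) := pow_le_pow_right₀ hY₁ (by nlinarith)
  set f := expPoly m (fun l ↦ σ (ξ l)) with hf
  set Λ := value m B G ξ u v with hΛ
  have hΛf : σ Λ = m ^ (N * v) * f (u + v * β) := map_value σ hB hG ξ u v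
  have hhouse : house (Λ : K) ≤ Y ^ (12 * (N * S)) := by
    refine (house_value_le hm hQC hu hv hS hξ).trans ?_
    calc _ ≤ Y ^ (2 * (N * S)) * (Y ^ (7 * (N * S)) * (Y ^ (2 * (N * S)) * Y ^ (N * S))) := by
          gcongr
      _ = Y ^ (12 * (N * S)) := by ring
  have hpoint {u v : ℕ} (hu : u ≤ S) (hv : v ≤ S) : ‖(u + v * β : ℂ)‖ ≤ S * L := by
    refine (norm_add_le _ _).trans ?_
    rw [norm_mul, Complex.norm_natCast, Complex.norm_natCast, hLdef, mul_add, mul_one]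
    gcongr
  have hsup (z : ℂ) (hz : ‖z‖ = 5 * (S * L)) : ‖f z‖ ≤ Y ^ (12 * (N * S)) := by
    have hmR : m * (5 * (S * L)) ≤ Y := by
      calc m * (5 * (S * L)) = m * (5 * L) * S := by ring
        _ ≤ Q * S := by gcongr
    have hexp : Real.exp (π * (5 * (S * L))) ≤ Y ^ S := by
      calc Real.exp (π * (5 * (S * L))) = Real.exp (π * (5 * L)) ^ S := by
            rw [← Real.exp_nat_mul]; ring_nf
        _ ≤ Y ^ S := by gcongr; exact hQe.trans hQY
    have hSL : 1 ≤ S * L := one_le_mul_of_one_le_of_one_le hS' hL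
    refine (norm_expPoly_le (fun l ↦ (norm_embedding_le_house (ξ l : K) σ).trans (hξ l))
      (one_le_mul_of_one_le_of_one_le hm' (by linarith)) (by positivity) hz.le).trans ?_
    calc _ ≤ Y ^ (2 * (N * S)) * (Y ^ (7 * (N * S)) * (Y ^ (2 * (N * S)) * (Y ^ S) ^ N)) := by
          gcongr ?_ * (_ * (?_ * ?_ ^ _))
          exact (pow_le_pow_left₀ (by positivity) hmR _).trans (pow_le_pow_right₀ hY₁ hd)
      _ = Y ^ (12 * (N * S)) := by ring
  have hsmall : ‖f (u + v * β)‖ ≤ Y ^ (12 * (N * S)) / 2 ^ (S * S) := by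
    classical
    let s : Finset ℂ := (Finset.range S ×ˢ Finset.range S).image fun p : ℕ × ℕ ↦ p.1 + p.2 * β
    have hs : s.card = S * S := by
      rw [Finset.card_image_of_injective _ (add_mul_injective hβ), Finset.card_product,
        Finset.card_range]
    have hmem (w : ℂ) (hw : w ∈ s) : ∃ u < S, ∃ v < S, w = u + v * β := by
      obtain ⟨p, hp, rfl⟩ := Finset.mem_image.1 hw
      rw [Finset.mem_product, Finset.mem_range, Finset.mem_range] at hp
      exact ⟨p.1, hp.1, p.2, hp.2, rfl⟩
    rw [← hs]
    refine (differentiable_expPoly m _).norm_le_div_two_pow_card (r := S * L) (by positivity)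
      (fun w hw ↦ ?_) (fun w hw ↦ ?_) hsup (hpoint hu hv)
    · obtain ⟨u, hu, v, hv, rfl⟩ := hmem w hw
      exact h u hu v hv
    · obtain ⟨u, hu, v, hv, rfl⟩ := hmem w hw
      exact hpoint hu.le hv.le
  have hΛsmall : ‖σ Λ‖ ≤ Y ^ (13 * (N * S)) / 2 ^ (S * S) := by
    rw [hΛf, norm_mul, norm_pow, Complex.norm_natCast]
    have hmQ : (m : ℝ) ≤ Y := by linarith [house_nonneg (B : K), house_nonneg (G : K)]
    calc (m : ℝ) ^ (N * v) * ‖f (u + v * β)‖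
        ≤ Y ^ (N * S) * (Y ^ (12 * (N * S)) / 2 ^ (S * S)) := by
          gcongr ?_ * ?_
          exact (pow_le_pow_left₀ (by positivity) hmQ _).trans
            (pow_le_pow_right₀ hY₁ (Nat.mul_le_mul_left _ hv))
      _ = Y ^ (13 * (N * S)) / 2 ^ (S * S) := by ring
  have hΛ₀ : Λ = 0 := by
    by_contra hne
    refine (one_le_norm_mul_house_pow σ hne).not_gt ?_
    obtain ⟨d, hd'⟩ : ∃ d, Module.finrank ℚ K = d + 1 :=
      Nat.exists_eq_add_one.2 Module.finrank_pos
    rw [hd'] at hlt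
    rw [hd', Nat.add_sub_cancel]
    calc _ ≤ Y ^ (13 * (N * S)) / 2 ^ (S * S) * (Y ^ (13 * (N * S))) ^ d := by
          refine mul_le_mul hΛsmall (pow_le_pow_left₀ (house_nonneg _) (hhouse.trans ?_) _)
            (pow_nonneg (house_nonneg _) _) (by positivity)
          exact pow_le_pow_right₀ hY₁ (Nat.mul_le_mul_right _ (by norm_num))
      _ = (Y ^ (13 * (d + 1) * N)) ^ S / (2 ^ S) ^ S := by ring
      _ < 1 := by
          rw [div_lt_one (by positivity)]
          exact pow_lt_pow_left₀ hlt (by positivity) (by lia)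
  simp only [hΛ₀, map_zero] at hΛf
  exact (mul_eq_zero.1 hΛf.symm).resolve_left (by positivity)

theorem false_of_irrational (σ : K →+* ℂ) {m : ℕ} {B G : 𝓞 K} {β : ℂ} (hm : m ≠ 0)
    (hB : σ B = m * β) (hG : σ G = m * Complex.exp (π * Complex.I * β)) (hβ : ∀ q : ℚ, β ≠ q) :
    False := by
  obtain ⟨c, hc⟩ := NumberField.house.exists_const_siegel K
  obtain ⟨Q, hQ⟩ : ∃ Q : ℝ, 2 + |c| + (m + house (B : K) + house (G : K)) + m * (5 * (1 + ‖β‖)) +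
    Real.exp (π * (5 * (1 + ‖β‖))) = Q := ⟨_, rfl⟩
  have hB₀ := house_nonneg (B : K)
  have hG₀ := house_nonneg (G : K)
  have hm₀ : (0 : ℝ) ≤ m := m.cast_nonneg
  have he₀ := Real.exp_pos (π * (5 * (1 + ‖β‖)))
  have hβ₀ : 0 ≤ m * (5 * (1 + ‖β‖)) := by positivity
  have hc₀ := abs_nonneg c
  have hQ₂ : 2 ≤ Q := by linarith
  have hQc : |c| ≤ Q := by linarith
  have hQC : m + house (B : K) + house (G : K) ≤ Q := by linarith
  obtain ⟨N, hN, hlt⟩ := exists_pow_mul_lt_two_pow (by linarith : 1 ≤ Q) (13 * Module.finrank ℚ K)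
  have hN2 : 1 ≤ N ^ 2 := Nat.one_le_pow 2 N hN
  have hNpos : 0 < N := hN
  let a : Matrix (Fin (N ^ 2) × Fin (N ^ 2)) (Fin (2 * N ^ 3) × Fin N) (𝓞 K) := fun k l ↦
    entry m B G N k.1 k.2 l.1 l.2
  have ha : a ≠ 0 := by
    intro h
    have := congrFun (congrFun h (⟨0, by positivity⟩, ⟨0, by positivity⟩))
      (⟨0, by positivity⟩, ⟨0, by positivity⟩)
    simp [a, entry] at this
  obtain ⟨ξ, hξ₀, hξ, hξh⟩ := hc (N ^ 2 * N ^ 2) _ _ a _ ha (by positivity) (by simp)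
    (by simp only [Fintype.card_prod, Fintype.card_fin]; ring) fun k l ↦
      house_entry_le hm hQC k.1.2.le k.2.2.le hN2 l.1.2.le l.2.2.le
  set Y : ℝ := Q * (N ^ 2 : ℕ) with hY
  have hN2' : (1 : ℝ) ≤ (N ^ 2 : ℕ) := by exact_mod_cast hN2
  have hQY : Q ≤ Y := le_mul_of_one_le_right (by linarith) hN2'
  have hY₁ : 1 ≤ Y := by linarith
  have hM : 1 ≤ N * N ^ 2 := Nat.mul_pos hN hN2
  have hXi (l) : house (ξ l : K) ≤ Y ^ (7 * (N * N ^ 2)) := by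
    have hcY : |c| ≤ Y ^ (N * N ^ 2) := (hQc.trans hQY).trans (le_self_pow₀ hY₁ (by lia))
    have hp : 2 * ((N ^ 2 * N ^ 2 : ℕ) : ℝ) ≤ Y ^ (2 * (N * N ^ 2)) := by
      refine le_trans ?_ (pow_le_pow_right₀ hY₁ (by lia : 2 ≤ 2 * (N * N ^ 2)))
      calc 2 * ((N ^ 2 * N ^ 2 : ℕ) : ℝ) = 2 * ((N ^ 2 : ℕ) : ℝ) ^ 2 := by push_cast; ring
        _ ≤ Q ^ 2 * ((N ^ 2 : ℕ) : ℝ) ^ 2 := by gcongr; nlinarith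
        _ = Y ^ 2 := by rw [hY, mul_pow]
    calc house (ξ l : K)
        ≤ |c| * (|c| * (2 * ((N ^ 2 * N ^ 2 : ℕ) : ℝ)) * (Y ^ (2 * N ^ 3) * Q ^ (N * N ^ 2))) := by
          refine (hξh l).trans ?_
          rw [mul_assoc c (2 * _), mul_assoc |c| (2 * _), ← mul_assoc c c, ← mul_assoc |c| |c|,
            abs_mul_abs_self]
      _ ≤ Y ^ (N * N ^ 2) * (Y ^ (N * N ^ 2) * Y ^ (2 * (N * N ^ 2)) *
          (Y ^ (2 * N ^ 3) * Y ^ (N * N ^ 2))) := by gcongr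
      _ = Y ^ (7 * (N * N ^ 2)) := by ring
  have hzero (S : ℕ) (hS : N ^ 2 ≤ S) :
      ∀ u < S, ∀ v < S, expPoly m (fun l ↦ σ (ξ l)) (u + v * β) = 0 := by
    induction S, hS using Nat.le_induction with
    | base =>
      intro u hu v hv
      have h := congrFun hξ (⟨u, hu⟩, ⟨v, hv⟩)
      have hval : value m B G ξ u v = 0 := by
        refine Eq.trans ?_ h
        exact Finset.sum_congr rfl fun l _ ↦ mul_comm _ _
      have hmap := map_value σ hB hG ξ u v
      simp only [hval, map_zero] at hmap
      exact (mul_eq_zero.1 hmap.symm).resolve_left (by positivity)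
    | succ S hS ih =>
      intro u hu v hv
      refine expPoly_eq_zero_of_forall_lt σ hm hB hG hβ hQ₂ hQC (by linarith) (by linarith) hN hS
        (hlt S hS) (fun l ↦ (hXi l).trans ?_) ih (Nat.le_of_lt_succ hu) (Nat.le_of_lt_succ hv)
      have hS' : ((N ^ 2 : ℕ) : ℝ) ≤ S := by exact_mod_cast hS
      have hYS : Y ≤ Q * S := by rw [hY]; gcongr
      exact (pow_le_pow_left₀ (by linarith) hYS _).trans
        (pow_le_pow_right₀ (hY₁.trans hYS) (by gcongr))
  have h := eq_zero_of_expPoly_eq_zero hm hβ fun u v ↦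
    hzero (N ^ 2 + u + v + 1) (by lia) u (by lia) v (by lia)
  refine hξ₀ (funext fun l ↦ ?_)
  have := congrFun h l
  simpa using this

end NumberField

theorem exists_nat_mul_isIntegral {x : ℂ} (hx : IsAlgebraic ℚ x) :
    ∃ m : ℕ, m ≠ 0 ∧ IsIntegral ℤ (m * x) := by
  obtain ⟨y, hy, h⟩ := ((IsFractionRing.isAlgebraic_iff ℤ ℚ ℂ).2 hx).exists_integral_multiple
  rw [zsmul_eq_mul] at h
  refine ⟨y.natAbs, Int.natAbs_ne_zero.2 hy, ?_⟩
  rw [← Int.cast_natCast (R := ℂ)]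
  rcases Int.natAbs_eq y with hy' | hy'
  · rwa [← hy']
  · rw [← neg_eq_iff_eq_neg.2 hy', Int.cast_neg, neg_mul]
    exact h.neg

end GelfondSchneider

/-- The case `α = -1` of the Gelfond–Schneider theorem. -/
theorem Complex.exists_eq_ratCast_of_isAlgebraic_exp {β : ℂ} (hβ : IsAlgebraic ℚ β)
    (hγ : IsAlgebraic ℚ (exp (π * I * β))) : ∃ q : ℚ, β = q := by
  by_contra! hirr
  set γ := exp (π * I * β)
  let K := IntermediateField.adjoin ℚ {β, γ}
  have : FiniteDimensional ℚ K := by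
    refine IntermediateField.finiteDimensional_adjoin fun x hx ↦ ?_
    rcases hx with rfl | rfl
    · exact hβ.isIntegral
    · exact hγ.isIntegral
  have : NumberField K := ⟨⟩
  have hinj := (algebraMap K ℂ).injective
  obtain ⟨m₁, hm₁, h₁⟩ := GelfondSchneider.exists_nat_mul_isIntegral hβ
  obtain ⟨m₂, hm₂, h₂⟩ := GelfondSchneider.exists_nat_mul_isIntegral hγ
  have hlift {x : ℂ} (hxK : x ∈ K) (hx : IsIntegral ℤ x) : ∃ X : 𝓞 K, algebraMap K ℂ X = x :=
    ⟨⟨⟨x, hxK⟩, (isIntegral_algebraMap_iff hinj).1 hx⟩, rfl⟩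
  have hβK : β ∈ K := IntermediateField.subset_adjoin _ _ (by simp)
  have hγK : γ ∈ K := IntermediateField.subset_adjoin _ _ (by simp)
  obtain ⟨B, hB⟩ := hlift (mul_mem (natCast_mem K (m₁ * m₂)) hβK) (by
    rw [mul_comm m₁, Nat.cast_mul, mul_assoc]
    exact (isIntegral_algebraMap (x := (m₂ : ℤ))).mul h₁)
  obtain ⟨G, hG⟩ := hlift (mul_mem (natCast_mem K (m₁ * m₂)) hγK) (by
    rw [Nat.cast_mul, mul_assoc]
    exact (isIntegral_algebraMap (x := (m₁ : ℤ))).mul h₂)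
  exact GelfondSchneider.false_of_irrational (algebraMap K ℂ) (mul_ne_zero hm₁ hm₂) hB hG hirr

/-- For rational `κ ∈ (4,8)`, every real `ρ ∈ (κ/4 − 1, κ/4)` with `ρ ≠ 1` and
`sin(8π/κ)·ρ = sin(8πρ/κ)` is transcendental over `ℚ`. -/
theorem rho_transcendental (κ : ℚ) (hκ₁ : 4 < κ) (hκ₂ : κ < 8) (ρ : ℝ)
    (h₁ : (κ : ℝ) / 4 - 1 < ρ) (h₂ : ρ < (κ : ℝ) / 4) (h₃ : ρ ≠ 1)
    (h₄ : Real.sin (8 * π / (κ : ℝ)) * ρ = Real.sin (8 * π * ρ / (κ : ℝ))) :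
    Transcendental ℚ ρ := by
  intro halg
  have hκ₁' : (4 : ℝ) < κ := by exact_mod_cast hκ₁
  have hκ₂' : (κ : ℝ) < 8 := by exact_mod_cast hκ₂
  obtain ⟨t, ht⟩ : ∃ t : ℚ, 8 / κ = t := ⟨_, rfl⟩
  have ht' : (t : ℝ) = 8 / κ := by rw [← ht]; push_cast; rfl
  have ht₁ : (1 : ℝ) < t := by rw [ht', lt_div_iff₀ (by positivity)]; linarith
  have ht₂ : (t : ℝ) < 2 := by rw [ht', div_lt_iff₀ (by positivity)]; linarith
  have h₄' : ρ * Real.sin (t * π) = Real.sin (t * ρ * π) := by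
    rw [mul_comm, ht', show 8 / (κ : ℝ) * π = 8 * π / κ by ring, h₄]
    ring_nf
  have hneg : Real.sin (t * π) < 0 := by
    have h := Real.sin_pos_of_pos_of_lt_pi (x := t * π - π)
      (by nlinarith [pi_pos]) (by nlinarith [pi_pos])
    rw [Real.sin_sub_pi] at h
    linarith
  have hβ : IsAlgebraic ℚ ((t * ρ : ℝ) : ℂ) :=
    ((isAlgebraic_algebraMap t).mul halg).algebraMap
  have hsin : IsAlgebraic ℚ (Complex.sin (t * ρ * π)) := by
    have h : Complex.sin (t * ρ * π) = ((ρ * Real.sin (t * π) : ℝ) : ℂ) := by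
      rw [h₄']; push_cast; rfl
    rw [h]
    exact (halg.mul ((IsFractionRing.isAlgebraic_iff ℤ ℚ ℝ).1
      (Real.isAlgebraic_sin_rat_mul_pi t))).algebraMap
  obtain ⟨q, hq⟩ := Complex.exists_eq_ratCast_of_isAlgebraic_exp hβ (by
    convert Complex.isAlgebraic_exp_mul_I_of_isAlgebraic_sin hsin using 2
    push_cast
    ring)
  have hq' : t * ρ = q := by exact_mod_cast hq
  have hρq : ((q / t : ℚ) : ℝ) = ρ := by
    push_cast
    rw [← hq', mul_div_cancel_left₀ _ (by positivity)]
  rw [hq', ← hρq] at h₄'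
  rw [← hρq] at h₁ h₂ h₃
  rcases Real.eq_of_mul_sin_eq_sin hneg.ne (by
    have : (0 : ℝ) < (q / t : ℚ) := by linarith
    exact_mod_cast this) h₄' with h | h | h
  · have hqt : q = t / 2 := by
      rw [div_eq_iff (by rintro rfl; norm_num at ht₁)] at h
      linarith
    rw [h, hqt, show (t : ℝ) * π = 2 * (t / 2 * π) by ring, Real.sin_two_mul] at h₄'
    push_cast at h₄'
    have hpos : 0 < Real.sin (t / 2 * π) :=
      Real.sin_pos_of_pos_of_lt_pi (by positivity) (by nlinarith [pi_pos])
    have hcos : Real.cos (t / 2 * π) < 0 :=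
      Real.cos_neg_of_pi_div_two_lt_of_lt (by nlinarith [pi_pos]) (by nlinarith [pi_pos])
    nlinarith
  · exact h₃ (by rw [h]; norm_num)
  · rw [h] at h₂
    push_cast at h₂
    linarith
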